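/- Under the adapted cuspidal-edge setting, the mean curvature H_{ŴFC} of the focal surface ŴFC_f = f + (λ/κ̂)ν, computed with respect to the unit normal n = (ŴFC_u×ŴFC_v)/|ŴFC_u×ŴFC_v| (which along the u-axis equals (f_u×ν)/|f_u|), satisfies, at every point (u₀,0) of the u-axis, H_{ŴFC}(u₀,0) = (1/8)·(κ_c(u₀)² − 4κ_s(u₀)). -/

import Mathlib

noncomputable section

local notation "⟪" x ", " y "⟫" => @inner ℝ _ _ x y

/-- Euclidean 3-space. -/
abbrev E3 : Type := EuclideanSpace ℝ (Fin 3)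

/-- The vector in `E3` with coordinates `(a, b, c)`. -/
def e3 (a b c : ℝ) : E3 := (WithLp.equiv 2 (Fin 3 → ℝ)).symm ![a, b, c]

/-- Cross product on `E3`. -/
def cross3 (a b : E3) : E3 :=
  e3 (a 1 * b 2 - a 2 * b 1) (a 2 * b 0 - a 0 * b 2) (a 0 * b 1 - a 1 * b 0)

/-- Scalar triple product `det(a,b,c)`. -/
def det3 (a b c : E3) : ℝ := ⟪a, cross3 b c⟫

/-- Partial derivative in the `u`-direction. -/
def pu {E : Type*} [NormedAddCommGroup E] [NormedSpace ℝ E] (g : ℝ × ℝ → E) (p : ℝ × ℝ) : E :=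
  fderiv ℝ g p (1, 0)

/-- Partial derivative in the `v`-direction. -/
def pv {E : Type*} [NormedAddCommGroup E] [NormedSpace ℝ E] (g : ℝ × ℝ → E) (p : ℝ × ℝ) : E :=
  fderiv ℝ g p (0, 1)

/-- Signed area density `λ = det(f_u, f_v, ν)`. -/
def lam (f ν : ℝ × ℝ → E3) (p : ℝ × ℝ) : ℝ := det3 (pu f p) (pv f p) (ν p)


/-- `Ẽ = |f_u|²`. -/
def Etil (f : ℝ × ℝ → E3) (p : ℝ × ℝ) : ℝ := ‖pu f p‖ ^ 2

/-- `F̃ = ⟨f_u, h⟩`. -/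
def Ftil (f h : ℝ × ℝ → E3) (p : ℝ × ℝ) : ℝ := ⟪pu f p, h p⟫

/-- `G̃ = |h|²`. -/
def Gtil (h : ℝ × ℝ → E3) (p : ℝ × ℝ) : ℝ := ‖h p‖ ^ 2

/-- `L̃ = −⟨f_u, ν_u⟩`. -/
def Ltil (f ν : ℝ × ℝ → E3) (p : ℝ × ℝ) : ℝ := -⟪pu f p, pu ν p⟫

/-- `M̃ = −⟨h, ν_u⟩`. -/
def Mtil (ν h : ℝ × ℝ → E3) (p : ℝ × ℝ) : ℝ := -⟪h p, pu ν p⟫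

/-- `Ñ = −⟨h, ν_v⟩`. -/
def Ntil (ν h : ℝ × ℝ → E3) (p : ℝ × ℝ) : ℝ := -⟪h p, pv ν p⟫

/-- `Ã = ẼÑ − 2vF̃M̃ + vG̃L̃`. -/
def Atil (f ν h : ℝ × ℝ → E3) (p : ℝ × ℝ) : ℝ :=
  Etil f p * Ntil ν h p - 2 * p.2 * Ftil f h p * Mtil ν h p + p.2 * Gtil h p * Ltil f ν p

/-- `B̃ = √(Ã² − 4v(ẼG̃−F̃²)(L̃Ñ−vM̃²))`. -/
def Btil (f ν h : ℝ × ℝ → E3) (p : ℝ × ℝ) : ℝ :=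
  Real.sqrt ((Atil f ν h p) ^ 2 -
    4 * p.2 * (Etil f p * Gtil h p - (Ftil f h p) ^ 2) *
      (Ltil f ν p * Ntil ν h p - p.2 * (Mtil ν h p) ^ 2))

/-- The bounded principal curvature `κ = 2(L̃Ñ−vM̃²)/(Ã+B̃)`. -/
def kap (f ν h : ℝ × ℝ → E3) (p : ℝ × ℝ) : ℝ :=
  2 * (Ltil f ν p * Ntil ν h p - p.2 * (Mtil ν h p) ^ 2) / (Atil f ν h p + Btil f ν h p)

/-- `κ̂ = (Ã+B̃)/(2|f_u×h|)`, the smooth extension of `λ·κ₁`. -/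
def kaphat (f ν h : ℝ × ℝ → E3) (p : ℝ × ℝ) : ℝ :=
  (Atil f ν h p + Btil f ν h p) / (2 * ‖cross3 (pu f p) (h p)‖)

/-- Singular curvature `κ_s` along the u-axis. -/
def kappas (f ν : ℝ × ℝ → E3) (u : ℝ) : ℝ :=
  det3 (pu f (u, 0)) (pu (pu f) (u, 0)) (ν (u, 0)) / ‖pu f (u, 0)‖ ^ 3

/-- Cuspidal curvature `κ_c` along the u-axis. -/
def kappac (f ν h : ℝ × ℝ → E3) (u : ℝ) : ℝ :=
  2 * Etil f (u, 0) ^ ((3 : ℝ) / 4) * Ntil ν h (u, 0) /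
    (Etil f (u, 0) * Gtil h (u, 0) - (Ftil f h (u, 0)) ^ 2) ^ ((3 : ℝ) / 4)

/-- Cusp-directional torsion `κ_t` along the u-axis. -/
def kappat (f ν h : ℝ × ℝ → E3) (u : ℝ) : ℝ :=
  (Etil f (u, 0) * Mtil ν h (u, 0) - Ftil f h (u, 0) * Ltil f ν (u, 0)) /
    (Etil f (u, 0) * Real.sqrt (Etil f (u, 0) * Gtil h (u, 0) - (Ftil f h (u, 0)) ^ 2))

/-- The focal surface `ŴFC_f = f + (λ/κ̂)ν`. -/
def FChat (f ν h : ℝ × ℝ → E3) (p : ℝ × ℝ) : E3 :=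
  f p + (lam f ν p / kaphat f ν h p) • ν p

/-- Coefficient `E` of the first fundamental form of a surface `W`. -/
def surfE (W : ℝ × ℝ → E3) (p : ℝ × ℝ) : ℝ := ‖pu W p‖ ^ 2

/-- Coefficient `F` of the first fundamental form of a surface `W`. -/
def surfF (W : ℝ × ℝ → E3) (p : ℝ × ℝ) : ℝ := ⟪pu W p, pv W p⟫

/-- Coefficient `G` of the first fundamental form of a surface `W`. -/
def surfG (W : ℝ × ℝ → E3) (p : ℝ × ℝ) : ℝ := ‖pv W p‖ ^ 2

/-- Unit normal `n = (W_u × W_v)/|W_u × W_v|` of a surface `W`. -/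
def surfn (W : ℝ × ℝ → E3) (p : ℝ × ℝ) : E3 :=
  ‖cross3 (pu W p) (pv W p)‖⁻¹ • cross3 (pu W p) (pv W p)

/-- Coefficient `L = ⟨W_uu, n⟩` of the second fundamental form. -/
def surfL (W : ℝ × ℝ → E3) (p : ℝ × ℝ) : ℝ := ⟪pu (pu W) p, surfn W p⟫

/-- Coefficient `M = ⟨W_uv, n⟩` of the second fundamental form. -/
def surfM (W : ℝ × ℝ → E3) (p : ℝ × ℝ) : ℝ := ⟪pv (pu W) p, surfn W p⟫

/-- Coefficient `N = ⟨W_vv, n⟩` of the second fundamental form. -/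
def surfN (W : ℝ × ℝ → E3) (p : ℝ × ℝ) : ℝ := ⟪pv (pv W) p, surfn W p⟫

/-- Gaussian curvature of a surface `W`. -/
def gaussK (W : ℝ × ℝ → E3) (p : ℝ × ℝ) : ℝ :=
  (surfL W p * surfN W p - (surfM W p) ^ 2) /
    (surfE W p * surfG W p - (surfF W p) ^ 2)

/-- Mean curvature of a surface `W` (w.r.t. the unit normal `surfn W`). -/
def meanH (W : ℝ × ℝ → E3) (p : ℝ × ℝ) : ℝ :=
  (surfE W p * surfN W p - 2 * surfF W p * surfM W p + surfG W p * surfL W p) /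
    (2 * (surfE W p * surfG W p - (surfF W p) ^ 2))


open scoped ContDiff

lemma inner_E3 (a b : E3) : ⟪a, b⟫ = a 0 * b 0 + a 1 * b 1 + a 2 * b 2 := by
  simp [PiLp.inner_apply, Fin.sum_univ_three, mul_comm]

@[simp] lemma cross3_apply_zero (a b : E3) : cross3 a b 0 = a 1 * b 2 - a 2 * b 1 := rfl

@[simp] lemma cross3_apply_one (a b : E3) : cross3 a b 1 = a 2 * b 0 - a 0 * b 2 := rfl

@[simp] lemma cross3_apply_two (a b : E3) : cross3 a b 2 = a 0 * b 1 - a 1 * b 0 := rfl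

lemma cross3_smul (c : ℝ) (a b : E3) : cross3 a (c • b) = c • cross3 a b := by
  ext i
  fin_cases i <;> simp <;> ring

/-- Lagrange's identity. -/
lemma norm_cross3_sq (a b : E3) : ‖cross3 a b‖ ^ 2 = ‖a‖ ^ 2 * ‖b‖ ^ 2 - ⟪a, b⟫ ^ 2 := by
  simp only [← real_inner_self_eq_norm_sq, inner_E3, cross3_apply_zero, cross3_apply_one,
    cross3_apply_two]
  ring

lemma inner_cross3_self (a b : E3) : ⟪b, cross3 a b⟫ = 0 := by
  simp only [inner_E3, cross3_apply_zero, cross3_apply_one, cross3_apply_two]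
  ring

lemma inner_cross3_cross3 (w a b : E3) :
    ⟪w, cross3 a (cross3 a b)⟫ = ⟪w, a⟫ * ⟪a, b⟫ - ⟪w, b⟫ * ‖a‖ ^ 2 := by
  simp only [← real_inner_self_eq_norm_sq, inner_E3, cross3_apply_zero, cross3_apply_one,
    cross3_apply_two]
  ring

lemma det3_swap (a b c : E3) : det3 a b c = -⟪b, cross3 a c⟫ := by
  simp only [det3, inner_E3, cross3_apply_zero, cross3_apply_one, cross3_apply_two]
  ring

lemma det3_rotate (a b c : E3) : det3 a b c = ⟪c, cross3 a b⟫ := by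
  simp only [det3, inner_E3, cross3_apply_zero, cross3_apply_one, cross3_apply_two]
  ring

lemma det3_smul_middle (c : ℝ) (a b d : E3) : det3 a (c • b) d = c * det3 a b d := by
  simp only [det3_swap, inner_smul_left, RCLike.conj_to_real, mul_neg]

section Calculus

variable {X : Type*} [NormedAddCommGroup X] [NormedSpace ℝ X]

lemma ContDiffAt.cross3 {n : WithTop ℕ∞} {a b : X → E3} {x : X} (ha : ContDiffAt ℝ n a x)
    (hb : ContDiffAt ℝ n b x) : ContDiffAt ℝ n (fun q => cross3 (a q) (b q)) x := by
  have ha' := contDiffAt_piLp 2 |>.1 ha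
  have hb' := contDiffAt_piLp 2 |>.1 hb
  refine (contDiffAt_piLp 2).2 fun i => ?_
  fin_cases i
  · exact ((ha' 1).mul (hb' 2)).sub ((ha' 2).mul (hb' 1))
  · exact ((ha' 2).mul (hb' 0)).sub ((ha' 0).mul (hb' 2))
  · exact ((ha' 0).mul (hb' 1)).sub ((ha' 1).mul (hb' 0))

lemma ContDiffAt.fderiv_apply_const {E : Type*} [NormedAddCommGroup E] [NormedSpace ℝ E]
    {g : X → E} {x : X} {m n : WithTop ℕ∞} (hg : ContDiffAt ℝ n g x) (hmn : m + 1 ≤ n) (d : X) :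
    ContDiffAt ℝ m (fun q => fderiv ℝ g q d) x :=
  (hg.fderiv_right hmn).clm_apply contDiffAt_const

variable {E : Type*} [NormedAddCommGroup E] [NormedSpace ℝ E]

lemma fderiv_add_smul_apply {f ν : X → E} {ρ : X → ℝ} {x : X}
    (hf : DifferentiableAt ℝ f x) (hν : DifferentiableAt ℝ ν x) (hρ : DifferentiableAt ℝ ρ x)
    (d : X) :
    fderiv ℝ (fun q => f q + ρ q • ν q) x d =
      fderiv ℝ f x d + (ρ x • fderiv ℝ ν x d + fderiv ℝ ρ x d • ν x) := by
  rw [fderiv_fun_add hf (hρ.fun_smul hν), fderiv_fun_smul hρ hν]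
  simp

/-- The second directional derivative of `f + ρ • ν` at a zero of `ρ`. -/
lemma fderiv_fderiv_add_smul_apply {f ν : X → E} {ρ : X → ℝ} {x : X}
    (hf : ContDiffAt ℝ 2 f x) (hν : ContDiffAt ℝ 2 ν x) (hρ : ContDiffAt ℝ 2 ρ x)
    (h0 : ρ x = 0) (d : X) :
    fderiv ℝ (fun q => fderiv ℝ (fun q => f q + ρ q • ν q) q d) x d =
      fderiv ℝ (fun q => fderiv ℝ f q d) x d + (2 * fderiv ℝ ρ x d) • fderiv ℝ ν x d +
        fderiv ℝ (fun q => fderiv ℝ ρ q d) x d • ν x := by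
  have h11 : (1 : WithTop ℕ∞) + 1 ≤ 2 := by norm_num
  have h2 : (2 : WithTop ℕ∞) ≠ ∞ := by decide
  have key : (fun q => fderiv ℝ (fun q => f q + ρ q • ν q) q d) =ᶠ[nhds x]
      fun q => (fderiv ℝ f q d + ρ q • fderiv ℝ ν q d) + fderiv ℝ ρ q d • ν q := by
    filter_upwards [hf.eventually h2, hν.eventually h2, hρ.eventually h2] with q h1 h2 h3
    rw [fderiv_add_smul_apply (h1.differentiableAt two_ne_zero)
      (h2.differentiableAt two_ne_zero) (h3.differentiableAt two_ne_zero), add_assoc]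
  have df := (hf.fderiv_apply_const h11 d).differentiableAt one_ne_zero
  have dν := (hν.fderiv_apply_const h11 d).differentiableAt one_ne_zero
  have dρ := (hρ.fderiv_apply_const h11 d).differentiableAt one_ne_zero
  have eν := hν.differentiableAt two_ne_zero
  have eρ := hρ.differentiableAt two_ne_zero
  rw [key.fderiv_eq, fderiv_add_smul_apply (df.fun_add (eρ.fun_smul dν)) eν dρ,
    fderiv_add_smul_apply df dν eρ, h0]
  module

end Calculus

lemma fderiv_snd_smul_apply {E : Type*} [NormedAddCommGroup E] [NormedSpace ℝ E]
    {g : ℝ × ℝ → E} {p : ℝ × ℝ} (hg : DifferentiableAt ℝ g p) (h0 : p.2 = 0) (d : ℝ × ℝ) :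
    fderiv ℝ (fun q => q.2 • g q) p d = d.2 • g p := by
  rw [fderiv_fun_smul differentiableAt_snd hg]
  simp [h0, fderiv_snd]

lemma pv_pu_eq_pu_pv {E : Type*} [NormedAddCommGroup E] [NormedSpace ℝ E] {g : ℝ × ℝ → E}
    {p : ℝ × ℝ} (hg : ContDiffAt ℝ 2 g p) : pv (pu g) p = pu (pv g) p := by
  have hd : DifferentiableAt ℝ (fderiv ℝ g) p :=
    (hg.fderiv_right (m := 1) (by norm_num)).differentiableAt one_ne_zero
  have e : ∀ d₁ d₂ : ℝ × ℝ, fderiv ℝ (fun q => fderiv ℝ g q d₁) p d₂ =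
      fderiv ℝ (fderiv ℝ g) p d₂ d₁ := fun d₁ d₂ => by
    rw [fderiv_clm_apply hd (differentiableAt_const d₁)]
    simp
  have hs : IsSymmSndFDerivAt ℝ g p := hg.isSymmSndFDerivAt (by simp)
  exact (e _ _).trans ((hs _ _).trans (e _ _).symm)

lemma contDiffAt_kaphat {f ν h : ℝ × ℝ → E3} {p : ℝ × ℝ} (hf : ContDiffAt ℝ ∞ f p)
    (hν : ContDiffAt ℝ ∞ ν p) (hh : ContDiffAt ℝ ∞ h p) (h0 : p.2 = 0)
    (hA : Atil f ν h p ≠ 0) (hc : cross3 (pu f p) (h p) ≠ 0) :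
    ContDiffAt ℝ ∞ (kaphat f ν h) p := by
  have h1 : (∞ : WithTop ℕ∞) + 1 ≤ ∞ := le_rfl
  have hfu : ContDiffAt ℝ ∞ (pu f) p := hf.fderiv_apply_const h1 _
  have hνu : ContDiffAt ℝ ∞ (pu ν) p := hν.fderiv_apply_const h1 _
  have hνv : ContDiffAt ℝ ∞ (pv ν) p := hν.fderiv_apply_const h1 _
  have hv : ContDiffAt ℝ ∞ (fun q : ℝ × ℝ => q.2) p := contDiffAt_snd
  have hE : ContDiffAt ℝ ∞ (Etil f) p := hfu.norm_sq ℝ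
  have hF : ContDiffAt ℝ ∞ (Ftil f h) p := hfu.inner ℝ hh
  have hG : ContDiffAt ℝ ∞ (Gtil h) p := hh.norm_sq ℝ
  have hL : ContDiffAt ℝ ∞ (Ltil f ν) p := (hfu.inner ℝ hνu).neg
  have hM : ContDiffAt ℝ ∞ (Mtil ν h) p := (hh.inner ℝ hνu).neg
  have hN : ContDiffAt ℝ ∞ (Ntil ν h) p := (hh.inner ℝ hνv).neg
  have hAt : ContDiffAt ℝ ∞ (Atil f ν h) p :=
    ((hE.mul hN).sub (((contDiffAt_const.mul hv).mul hF).mul hM)).add ((hv.mul hG).mul hL)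
  have hB : ContDiffAt ℝ ∞ (Btil f ν h) p := by
    refine ContDiffAt.sqrt ((hAt.pow 2).sub (((contDiffAt_const.mul hv).mul
      ((hE.mul hG).sub (hF.pow 2))).mul ((hL.mul hN).sub (hv.mul (hM.pow 2))))) ?_
    simpa [h0] using hA
  exact (hAt.add hB).div (contDiffAt_const.mul ((hfu.cross3 hh).norm ℝ hc)) (by simpa using hc)

lemma rpow_three_quarters_sq {x : ℝ} (hx : 0 ≤ x) : ((x ^ 2) ^ ((3 : ℝ) / 4)) ^ 2 = x ^ 3 := by
  rw [← Real.rpow_natCast_mul hx, ← Real.rpow_mul_natCast hx, ← Real.rpow_natCast x 3]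
  norm_num


/-- along the u-axis, the unit normal of the focal surface `ŴFC_f` is
`(f_u×ν)/|f_u|` and its mean curvature is `H = (1/8)(κ_c² − 4κ_s)`. -/
theorem stmt13
    (U : Set (ℝ × ℝ)) (hU : IsOpen U)
    (f ν h : ℝ × ℝ → E3)
    (hf : ContDiffOn ℝ (⊤ : ℕ∞) f U) (hν : ContDiffOn ℝ (⊤ : ℕ∞) ν U) (hhsm : ContDiffOn ℝ (⊤ : ℕ∞) h U)
    (hax : ∃ p ∈ U, p.2 = (0 : ℝ))
    (hν1 : ∀ p ∈ U, ‖ν p‖ = 1)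
    (ho1 : ∀ p ∈ U, (⟪pu f p, ν p⟫ : ℝ) = 0)
    (ho2 : ∀ p ∈ U, (⟪pv f p, ν p⟫ : ℝ) = 0)
    (hfront : ∀ p ∈ U, Function.Injective ⇑(fderiv ℝ (fun q => (f q, ν q)) p))
    (hlam : ∀ p ∈ U, (lam f ν p = 0 ↔ p.2 = 0))
    (hh0 : ∀ p ∈ U, h p ≠ 0)
    (hfv : ∀ p ∈ U, pv f p = p.2 • h p)
    (hνdef : ∀ p ∈ U, ν p = ‖cross3 (pu f p) (h p)‖⁻¹ • cross3 (pu f p) (h p))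
    (hNpos : ∀ p ∈ U, p.2 = 0 → 0 < Ntil ν h p)
    (u₀ : ℝ) (hp : ((u₀, 0) : ℝ × ℝ) ∈ U) :
    surfn (FChat f ν h) (u₀, 0) =
      ‖pu f (u₀, 0)‖⁻¹ • cross3 (pu f (u₀, 0)) (ν (u₀, 0)) ∧
    meanH (FChat f ν h) (u₀, 0) =
      (1 / 8) * ((kappac f ν h u₀) ^ 2 - 4 * kappas f ν u₀) := by
  set p : ℝ × ℝ := (u₀, 0) with hpdef
  have hUp : U ∈ nhds p := hU.mem_nhds hp
  have hp2 : p.2 = 0 := rfl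
  have h11 : (∞ : WithTop ℕ∞) + 1 ≤ ∞ := le_rfl
  have h2 : (2 : WithTop ℕ∞) ≤ ∞ := WithTop.coe_le_coe.2 le_top
  have hn0 : (∞ : WithTop ℕ∞) ≠ 0 := by simp
  have cf : ContDiffAt ℝ ∞ f p := hf.contDiffAt hUp
  have cν : ContDiffAt ℝ ∞ ν p := hν.contDiffAt hUp
  have ch : ContDiffAt ℝ ∞ h p := hhsm.contDiffAt hUp
  have cfu : ContDiffAt ℝ ∞ (pu f) p := cf.fderiv_apply_const h11 _
  have hc : cross3 (pu f p) (h p) ≠ 0 := fun h0 => by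
    have := hν1 p hp
    rw [hνdef p hp, h0] at this
    simp at this
  have hr : 0 < ‖cross3 (pu f p) (h p)‖ := norm_pos_iff.2 hc
  have hr2 := norm_cross3_sq (pu f p) (h p)
  have ha : 0 < ‖pu f p‖ := norm_pos_iff.2 fun h0 => by
    refine hc (norm_eq_zero.1 (sq_eq_zero_iff.1 (hr2.trans ?_)))
    simp [h0]
  have hN : 0 < Ntil ν h p := hNpos p hp rfl
  have hA : Atil f ν h p = ‖pu f p‖ ^ 2 * Ntil ν h p := by simp [Atil, hp2, Etil]
  have hA0 : 0 < Atil f ν h p := by rw [hA]; positivity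
  have hB : Btil f ν h p = Atil f ν h p := by simp [Btil, hp2, Real.sqrt_sq hA0.le]
  have hk : kaphat f ν h p = ‖pu f p‖ ^ 2 * Ntil ν h p / ‖cross3 (pu f p) (h p)‖ := by
    rw [kaphat, hB, hA]
    field_simp
    ring
  have hk0 : kaphat f ν h p ≠ 0 := by rw [hk]; positivity
  -- the offset `lam / kaphat` is `v` times a smooth function
  set g : ℝ × ℝ → ℝ := fun q => ‖cross3 (pu f q) (h q)‖ / kaphat f ν h q with hg
  have cg : ContDiffAt ℝ ∞ g p :=
    ((cfu.cross3 ch).norm ℝ hc).div (contDiffAt_kaphat cf cν ch hp2 hA0.ne' hc) hk0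
  have hgp : g p = ‖cross3 (pu f p) (h p)‖ ^ 2 / (‖pu f p‖ ^ 2 * Ntil ν h p) := by
    simp only [hg, hk]
    field_simp
  have hg0 : 0 < g p := by rw [hgp]; positivity
  set ρ : ℝ × ℝ → ℝ := fun q => q.2 • g q with hρ
  have cρ : ContDiffAt ℝ ∞ ρ p := contDiffAt_snd.smul cg
  have hρ0 : ρ p = 0 := by simp [hρ, hp2]
  have dρ : ∀ d : ℝ × ℝ, fderiv ℝ ρ p d = d.2 • g p :=
    fderiv_snd_smul_apply (cg.differentiableAt hn0) hp2
  have hW : FChat f ν h =ᶠ[nhds p] fun q => f q + ρ q • ν q := by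
    filter_upwards [hUp] with q hq
    have hn : ⟪ν q, cross3 (pu f q) (h q)⟫ = ‖cross3 (pu f q) (h q)‖ := by
      rw [hνdef q hq, real_inner_smul_left, real_inner_self_eq_norm_sq]
      by_cases h0 : ‖cross3 (pu f q) (h q)‖ = 0
      · simp [h0]
      · field_simp
    rw [FChat, lam, hfv q hq, det3_smul_middle, det3_rotate, hn, mul_div_assoc, ← smul_eq_mul]
  have hW1 : ∀ d : ℝ × ℝ, fderiv ℝ (FChat f ν h) p d = fderiv ℝ f p d + (d.2 * g p) • ν p := by
    intro d
    rw [hW.fderiv_eq, fderiv_add_smul_apply (cf.differentiableAt hn0) (cν.differentiableAt hn0)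
      (cρ.differentiableAt hn0), hρ0, dρ]
    simp
  have hW2 : ∀ d : ℝ × ℝ, ∃ t : ℝ, fderiv ℝ (fun q => fderiv ℝ (FChat f ν h) q d) p d =
      fderiv ℝ (fun q => fderiv ℝ f q d) p d + (2 * (d.2 * g p)) • fderiv ℝ ν p d + t • ν p := by
    intro d
    have key : (fun q => fderiv ℝ (FChat f ν h) q d) =ᶠ[nhds p]
        fun q => fderiv ℝ (fun q => f q + ρ q • ν q) q d :=
      hW.fderiv.fun_comp (fun L => L d)
    rw [key.fderiv_eq, fderiv_fderiv_add_smul_apply (cf.of_le h2) (cν.of_le h2) (cρ.of_le h2) hρ0,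
      dρ]
    exact ⟨_, rfl⟩
  have hfv' : pv f =ᶠ[nhds p] fun q => q.2 • h q := by
    filter_upwards [hUp] with q hq using hfv q hq
  have dfv : ∀ d : ℝ × ℝ, fderiv ℝ (pv f) p d = d.2 • h p := fun d => by
    rw [hfv'.fderiv_eq, fderiv_snd_smul_apply (ch.differentiableAt hn0) hp2]
  have hWu : pu (FChat f ν h) p = pu f p := (hW1 (1, 0)).trans (by simp [pu])
  have hz : fderiv ℝ f p (0, 1) = 0 := (hfv p hp).trans (by simp [hp2])
  have hWv : pv (FChat f ν h) p = g p • ν p := (hW1 (0, 1)).trans (by simp [hz])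
  obtain ⟨s, hWuu⟩ := hW2 (1, 0)
  obtain ⟨t, hWvv⟩ := hW2 (0, 1)
  have hWuu' : pu (pu (FChat f ν h)) p = pu (pu f) p + s • ν p :=
    hWuu.trans (by simp; rfl)
  have hWvv' : pv (pv (FChat f ν h)) p = h p + (2 * g p) • pv ν p + t • ν p := by
    have h1 : fderiv ℝ (fun q => fderiv ℝ f q (0, 1)) p (0, 1) = h p :=
      (dfv (0, 1)).trans (by simp)
    rw [h1] at hWvv
    exact hWvv.trans (by simp [pv])
  have hνc : ‖cross3 (pu f p) (ν p)‖ = ‖pu f p‖ := by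
    rw [← sq_eq_sq₀ (norm_nonneg _) (norm_nonneg _), norm_cross3_sq, hν1 p hp, ho1 p hp]
    simp
  have hn : surfn (FChat f ν h) p = ‖pu f p‖⁻¹ • cross3 (pu f p) (ν p) := by
    rw [surfn, hWu, hWv, cross3_smul, norm_smul, hνc, smul_smul, Real.norm_of_nonneg hg0.le]
    congr 1
    field_simp
  refine ⟨hn, ?_⟩
  have hνv : ⟪pv ν p, pu f p⟫ = 0 := by
    have h0 : (fun q => ⟪pu f q, ν q⟫) =ᶠ[nhds p] fun _ => (0 : ℝ) := by
      filter_upwards [hUp] with q hq using ho1 q hq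
    have h1 : fderiv ℝ (fun q => ⟪pu f q, ν q⟫) p (0, 1) = 0 := by
      rw [h0.fderiv_eq]
      simp
    rw [fderiv_inner_apply ℝ (cfu.differentiableAt hn0) (cν.differentiableAt hn0)] at h1
    have h3 : fderiv ℝ (pu f) p (0, 1) = 0 :=
      (pv_pu_eq_pu_pv (cf.of_le h2)).trans ((dfv (1, 0)).trans (by simp))
    rw [h3] at h1
    rw [real_inner_comm]
    simpa [pv] using h1
  have hinner : ∀ w : E3, ⟪w, cross3 (pu f p) (ν p)⟫ = ‖cross3 (pu f p) (h p)‖⁻¹ *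
      (⟪w, pu f p⟫ * ⟪pu f p, h p⟫ - ⟪w, h p⟫ * ‖pu f p‖ ^ 2) := fun w => by
    rw [← inner_cross3_cross3, ← real_inner_smul_right, ← cross3_smul, ← hνdef p hp]
  have hE : surfE (FChat f ν h) p = ‖pu f p‖ ^ 2 := by rw [surfE, hWu]
  have hF : surfF (FChat f ν h) p = 0 := by
    rw [surfF, hWu, hWv, real_inner_smul_right, ho1 p hp, mul_zero]
  have hG : surfG (FChat f ν h) p = g p ^ 2 := by
    rw [surfG, hWv, norm_smul, hν1 p hp, mul_one, Real.norm_eq_abs, sq_abs]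
  have hL : surfL (FChat f ν h) p =
      ‖pu f p‖⁻¹ * ⟪pu (pu f) p, cross3 (pu f p) (ν p)⟫ := by
    rw [surfL, hn, hWuu', real_inner_smul_right, inner_add_left, real_inner_smul_left,
      inner_cross3_self, mul_zero, add_zero]
  have hNN : surfN (FChat f ν h) p = ‖pu f p‖⁻¹ * ‖cross3 (pu f p) (h p)‖ := by
    have e1 : ⟪h p, cross3 (pu f p) (ν p)⟫ = -‖cross3 (pu f p) (h p)‖ := by
      rw [hinner, real_inner_comm (pu f p) (h p), real_inner_self_eq_norm_sq,
        show ∀ x y z : ℝ, x * x - y * z = -(z * y - x ^ 2) by intros; ring, ← hr2]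
      field_simp
    have e2 : ⟪pv ν p, cross3 (pu f p) (ν p)⟫ =
        ‖cross3 (pu f p) (h p)‖⁻¹ * (Ntil ν h p * ‖pu f p‖ ^ 2) := by
      rw [hinner, hνv, Ntil, real_inner_comm (h p) (pv ν p)]
      ring
    rw [surfN, hn, hWvv', real_inner_smul_right, inner_add_left, inner_add_left,
      real_inner_smul_left, real_inner_smul_left, inner_cross3_self, e1, e2, hgp]
    field_simp
    ring
  have hκs : kappas f ν u₀ = -⟪pu (pu f) p, cross3 (pu f p) (ν p)⟫ / ‖pu f p‖ ^ 3 := by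
    rw [kappas, det3_swap]
  have hκc : kappac f ν h u₀ ^ 2 =
      4 * ‖pu f p‖ ^ 3 * Ntil ν h p ^ 2 / ‖cross3 (pu f p) (h p)‖ ^ 3 := by
    rw [kappac, ← hpdef, Etil, Gtil, Ftil, ← hr2, div_pow, mul_pow, mul_pow,
      rpow_three_quarters_sq ha.le, rpow_three_quarters_sq hr.le]
    norm_num
  rw [meanH, hE, hF, hG, hL, hNN, hκs, hκc, hgp]
  field_simp
  ring
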